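/- For all θ > 0, σ > 0 and x₀ ≥ 0, ∫_{x₀}^∞ ((x - x₀)/(σ + x)) · (1 + x₀/σ)^θ (θ/σ)(1 + x/σ)^{-(θ+1)} dx = 1/(θ+1); that is, under the left-censored q-exponential density, the expectation of (X - x₀)/(σ + X) equals 1/(θ+1). -/

import Mathlib

theorem tendsto_one_add_div_rpow_neg_atTop {σ s : ℝ} (hσ : 0 < σ) (hs : 0 < s) :
    Filter.Tendsto (fun x : ℝ ↦ (1 + x / σ) ^ (-s)) Filter.atTop (nhds 0) :=
  (tendsto_rpow_neg_atTop hs).comp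
    (Filter.tendsto_atTop_add_const_left _ 1 (Filter.tendsto_id.atTop_div_const hσ))

theorem hasDerivAt_one_add_div_rpow_neg {σ x : ℝ} (s : ℝ) (hx : 0 < 1 + x / σ) :
    HasDerivAt (fun y : ℝ ↦ (1 + y / σ) ^ (-s)) (-(s / σ) * (1 + x / σ) ^ (-(s + 1))) x := by
  have h := (((hasDerivAt_id x).div_const σ).const_add 1).rpow_const (p := -s) (Or.inl hx.ne')
  refine h.congr_deriv ?_
  rw [show -(s + 1) = -s - 1 by ring]
  simp only [id_eq]
  ring

open MeasureTheory

/-- Under the left-censored q-exponential density at threshold `x₀`, the expectation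
of `(X - x₀)/(σ + X)` equals `1/(θ+1)`. -/
theorem qexp_censored_expectation (θ σ x₀ : ℝ)
    (hθ : 0 < θ) (hσ : 0 < σ) (hx₀ : 0 ≤ x₀) :
    ∫ x in Set.Ioi x₀,
        ((x - x₀) / (σ + x)) *
          ((1 + x₀ / σ) ^ θ * ((θ / σ) * (1 + x / σ) ^ (-(θ + 1)))) =
      1 / (θ + 1) := by
  have hθ' : 0 < θ + 1 := by linarith
  have hc : 0 < 1 + x₀ / σ := by positivity
  let F : ℝ → ℝ := fun x ↦ (1 + x₀ / σ) ^ θ *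
    ((1 + x₀ / σ) * θ / (θ + 1) * (1 + x / σ) ^ (-(θ + 1)) - (1 + x / σ) ^ (-θ))
  have hderiv : ∀ x ∈ Set.Ici x₀, HasDerivAt F (((x - x₀) / (σ + x)) *
      ((1 + x₀ / σ) ^ θ * ((θ / σ) * (1 + x / σ) ^ (-(θ + 1))))) x := by
    intro x hx
    have hx0 : 0 ≤ x := hx₀.trans hx
    have hu : 0 < 1 + x / σ := by positivity
    refine HasDerivAt.congr_deriv ((((hasDerivAt_one_add_div_rpow_neg (θ + 1) hu).const_mul
      ((1 + x₀ / σ) * θ / (θ + 1))).sub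
        (hasDerivAt_one_add_div_rpow_neg θ hu)).const_mul ((1 + x₀ / σ) ^ θ)) ?_
    rw [show -(θ + 1 + 1) = -(θ + 1) - 1 by ring, Real.rpow_sub_one hu.ne']
    have hσx : σ + x ≠ 0 := by positivity
    generalize (1 + x / σ) ^ (-(θ + 1)) = a
    generalize (1 + x₀ / σ) ^ θ = b
    field_simp
    ring
  have hlim : Filter.Tendsto F Filter.atTop (nhds 0) := by
    simpa only [mul_zero, sub_zero] using (((tendsto_one_add_div_rpow_neg_atTop hσ hθ').const_mul
      ((1 + x₀ / σ) * θ / (θ + 1))).sub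
        (tendsto_one_add_div_rpow_neg_atTop hσ hθ)).const_mul ((1 + x₀ / σ) ^ θ)
  have hnonneg : ∀ x ∈ Set.Ioi x₀, 0 ≤ ((x - x₀) / (σ + x)) *
      ((1 + x₀ / σ) ^ θ * ((θ / σ) * (1 + x / σ) ^ (-(θ + 1)))) := by
    intro x hx
    have hx0 : 0 ≤ x := hx₀.trans (le_of_lt hx)
    have hsub : 0 ≤ x - x₀ := sub_nonneg.mpr (le_of_lt hx)
    positivity
  rw [integral_Ioi_of_hasDerivAt_of_nonneg' hderiv hnonneg hlim]
  simp only [F]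
  rw [show -(θ + 1) = -θ - 1 by ring, Real.rpow_sub_one hc.ne', Real.rpow_neg hc.le]
  have hb : 0 < (1 + x₀ / σ) ^ θ := Real.rpow_pos_of_pos hc θ
  generalize (1 + x₀ / σ) ^ θ = b at hb ⊢
  generalize 1 + x₀ / σ = c at hc ⊢
  field_simp
  ring
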